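/- arXiv:1902.01911 — 6 statements merged into one kernel-verified Lean document; each statement's English description precedes it below -/
import Mathlib

section
/- Let 𝒰 ⊆ ℝ^d, m ≤ n, and for each multi-index j ∈ {1,…,n}^m let κ_j : 𝒰^m → ℝ. Define the V-statistic V : 𝒰^n → ℝ by V(x) = n^{−m} Σ_{j ∈ {1,…,n}^m} κ_j(x_{j_1},…,x_{j_m}). If M_Lip(κ_j) ≤ L for all multi-indices j, then M_Lip(V) ≤ L m / n. -/
/-- The `k`-th partial difference operator:
`D^k_{y,y'} f(x) = f(…,x_{k-1},y,x_{k+1},…) - f(…,x_{k-1},y',x_{k+1},…)`. -/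
def pdiff {α : Type*} {n : ℕ} (f : (Fin n → α) → ℝ) (k : Fin n) (y y' : α)
    (x : Fin n → α) : ℝ :=
  f (Function.update x k y) - f (Function.update x k y')

theorem vstat_tele {α : Type*} {n m : ℕ} (U : Set α) (f : (Fin m → α) → ℝ) (j : Fin m → Fin n)
    (C : ℝ) (k : Fin n) (y y' : α) (hy : y ∈ U) (hy' : y' ∈ U)
    (hf : ∀ u : Fin m → α, (∀ i, u i ∈ U) → ∀ a, pdiff f a y y' u ≤ C)
    (x : Fin n → α) (hx : ∀ i, x i ∈ U) (S : Finset (Fin m)) :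
    f (fun i => if j i = k then (if i ∈ S then y else y') else x (j i))
      - f (fun i => if j i = k then y' else x (j i)) ≤ ∑ i ∈ S, if j i = k then C else 0 := by
  induction S using Finset.induction_on with
  | empty => simp
  | insert a S ha ih =>
    rw [Finset.sum_insert ha]
    by_cases hk : j a = k
    · have h := hf (fun i => if j i = k then (if i ∈ S then y else y') else x (j i))
        (by intro i; split_ifs <;> simp_all) a
      unfold pdiff at h
      have e1 : Function.update
          (fun i => if j i = k then (if i ∈ S then y else y') else x (j i)) a y
          = fun i => if j i = k then (if i ∈ insert a S then y else y') else x (j i) := by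
        funext i
        by_cases hi : i = a
        · subst hi; simp [hk]
        · simp [hi]
      have e2 : Function.update
          (fun i => if j i = k then (if i ∈ S then y else y') else x (j i)) a y'
          = fun i => if j i = k then (if i ∈ S then y else y') else x (j i) := by
        funext i
        by_cases hi : i = a
        · subst hi; simp [hk, ha]
        · simp [hi]
      rw [e1, e2] at h
      rw [if_pos hk]
      linarith
    · have e1 : (fun i => if j i = k then (if i ∈ insert a S then y else y') else x (j i))
          = fun i => if j i = k then (if i ∈ S then y else y') else x (j i) := by
        funext i
        by_cases hi : i = a
        · subst hi; simp [hk]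
        · simp [hi]
      rw [e1, if_neg hk]
      linarith

theorem vstat_count {n m : ℕ} (i : Fin m) (k : Fin n) (C : ℝ) :
    ∑ j : Fin m → Fin n, (if j i = k then C else 0) = (n : ℝ) ^ (m - 1) * C := by
  have h := Fintype.card_filter_piFinset_const_eq_of_mem (Finset.univ : Finset (Fin n)) i
    (Finset.mem_univ k)
  simp only [Fintype.piFinset_univ, Finset.card_univ, Fintype.card_fin] at h
  rw [← Finset.sum_filter, Finset.sum_const, h]
  simp

/-- If all kernels `κ_j` of the V-statistic
`V(x) = n^{-m} ∑_{j ∈ {1,…,n}^m} κ_j(x_{j_1},…,x_{j_m})` satisfy `M_Lip(κ_j) ≤ L`,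
then `M_Lip(V) ≤ L m / n`. -/
theorem vstatistic_MLip {d n m : ℕ} (hmn : m ≤ n)
    (U : Set (EuclideanSpace ℝ (Fin d)))
    (κ : (Fin m → Fin n) → (Fin m → EuclideanSpace ℝ (Fin d)) → ℝ)
    (L : ℝ)
    (hκ : ∀ (j : Fin m → Fin n) (u : Fin m → EuclideanSpace ℝ (Fin d)),
      (∀ i, u i ∈ U) → ∀ (k : Fin m) (y y' : EuclideanSpace ℝ (Fin d)),
      y ∈ U → y' ∈ U → pdiff (κ j) k y y' u ≤ L * ‖y - y'‖)
    (V : (Fin n → EuclideanSpace ℝ (Fin d)) → ℝ)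
    (hV : V = fun x => ((n : ℝ) ^ m)⁻¹ *
      ∑ j : Fin m → Fin n, κ j (fun i => x (j i))) :
    ∀ (x : Fin n → EuclideanSpace ℝ (Fin d)), (∀ i, x i ∈ U) →
      ∀ (k : Fin n) (y y' : EuclideanSpace ℝ (Fin d)), y ∈ U → y' ∈ U →
      pdiff V k y y' x ≤ (L * m / n) * ‖y - y'‖ := by
  intro x hx k y y' hy hy'
  have hn : (n : ℝ) ≠ 0 := by
    have := k.pos
    positivity
  have key : ∀ j : Fin m → Fin n,
      κ j (fun i => Function.update x k y (j i)) - κ j (fun i => Function.update x k y' (j i))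
        ≤ ∑ i, if j i = k then L * ‖y - y'‖ else 0 := by
    intro j
    have h := vstat_tele U (κ j) j (L * ‖y - y'‖) k y y' hy hy'
      (fun u hu a => hκ j u hu a y y' hy hy') x hx Finset.univ
    simpa [Function.update_apply] using h
  have hs := Finset.sum_le_sum (fun j (_ : j ∈ Finset.univ) => key j)
  rw [Finset.sum_comm, Finset.sum_sub_distrib] at hs
  simp only [vstat_count, Finset.sum_const, Finset.card_univ, Fintype.card_fin,
    nsmul_eq_mul] at hs
  subst hV
  unfold pdiff
  dsimp only
  rw [← mul_sub]
  refine (mul_le_mul_of_nonneg_left hs (by positivity)).trans (le_of_eq ?_)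
  rcases m with _ | m
  · simp
  · simp only [Nat.add_sub_cancel]
    field_simp
    ring
end

section
/- Let 𝒰 ⊆ ℝ^d, m ≤ n, and for each increasing multi-index j = (j_1 < … < j_m) with entries in {1,…,n} let κ_j : 𝒰^m → ℝ. Define the U-statistic U : 𝒰^n → ℝ by U(x) = C(n,m)^{−1} Σ_{1 ≤ j_1 < … < j_m ≤ n} κ_j(x_{j_1},…,x_{j_m}), where C(n,m) is the binomial coefficient. If M_Lip(κ_j) ≤ L for all such multi-indices j, then M_Lip(U) ≤ L m / n. -/
open scoped Classical in
theorem count_aux (n m : ℕ) (k : Fin n) :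
    (Finset.univ.filter (fun j : Fin m → Fin n => StrictMono j ∧ ∃ i, j i = k)).card * n
      = m * n.choose m := by
  have h1 : (Finset.univ.filter (fun j : Fin m → Fin n => StrictMono j ∧ ∃ i, j i = k)).card
      = ((Finset.powersetCard m (Finset.univ : Finset (Fin n))).filter (fun s => k ∈ s)).card := by
    refine Finset.card_bij (fun j _ => Finset.univ.image j) ?_ ?_ ?_
    · intro j hj
      simp only [Finset.mem_filter, Finset.mem_univ, true_and] at hj
      obtain ⟨hj, i, hi⟩ := hj
      simp only [Finset.mem_filter, Finset.mem_powersetCard, Finset.subset_univ, true_and]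
      refine ⟨?_, ?_⟩
      · rw [Finset.card_image_of_injective _ hj.injective]; simp
      · simp only [Finset.mem_image, Finset.mem_univ, true_and]
        exact ⟨i, hi⟩
    · intro a ha b hb hab
      simp only [Finset.mem_filter, Finset.mem_univ, true_and] at ha hb
      have h : Set.range a = Set.range b := by
        have := congrArg (fun s : Finset (Fin n) => (s : Set (Fin n))) hab
        simpa using this
      exact (StrictMono.range_inj ha.1 hb.1).1 h
    · intro s hs
      simp only [Finset.mem_filter, Finset.mem_powersetCard, Finset.subset_univ, true_and] at hs
      obtain ⟨hc, hk⟩ := hs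
      have hr := Finset.range_orderEmbOfFin s hc
      refine ⟨s.orderEmbOfFin hc, ?_, ?_⟩
      · simp only [Finset.mem_filter, Finset.mem_univ, true_and]
        refine ⟨(s.orderEmbOfFin hc).strictMono, ?_⟩
        have : k ∈ Set.range (s.orderEmbOfFin hc) := by rw [hr]; exact hk
        exact this
      · apply Finset.coe_injective
        simp [hr]
  have h2 : ((Finset.powersetCard m (Finset.univ : Finset (Fin n))).filter (fun s => ¬ k ∈ s))
      = Finset.powersetCard m (Finset.univ.erase k) := by
    ext s
    simp only [Finset.mem_filter, Finset.mem_powersetCard, Finset.subset_univ, true_and,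
      Finset.subset_erase]
    tauto
  have h3 := Finset.card_filter_add_card_filter_not
    (s := Finset.powersetCard m (Finset.univ : Finset (Fin n))) (fun s => k ∈ s)
  rw [h2, ← h1, Finset.card_powersetCard, Finset.card_powersetCard,
    Finset.card_erase_of_mem (Finset.mem_univ k), Finset.card_univ, Fintype.card_fin] at h3
  have hn : 0 < n := k.pos
  obtain ⟨n, rfl⟩ : ∃ p, n = p + 1 := ⟨n - 1, by omega⟩
  cases m with
  | zero =>
    simp only [Nat.choose_zero_right] at h3
    simp only [zero_mul, mul_eq_zero]
    left; omega
  | succ m =>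
    rw [Nat.add_sub_cancel, Nat.choose_succ_succ] at h3
    have h4 := Nat.add_one_mul_choose_eq n m
    have h5 := Nat.add_right_cancel h3
    rw [h5, mul_comm, h4, mul_comm]

open scoped Classical in
/-- If all kernels `κ_j`, for increasing multi-indices `j`, of the U-statistic
`U(x) = C(n,m)⁻¹ ∑_{j_1 < … < j_m} κ_j(x_{j_1},…,x_{j_m})` satisfy `M_Lip(κ_j) ≤ L`,
then `M_Lip(U) ≤ L m / n`. -/
theorem ustatistic_MLip {d n m : ℕ} (hmn : m ≤ n)
    (U : Set (EuclideanSpace ℝ (Fin d)))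
    (κ : (Fin m → Fin n) → (Fin m → EuclideanSpace ℝ (Fin d)) → ℝ)
    (L : ℝ)
    (hκ : ∀ (j : Fin m → Fin n), StrictMono j →
      ∀ (u : Fin m → EuclideanSpace ℝ (Fin d)),
      (∀ i, u i ∈ U) → ∀ (k : Fin m) (y y' : EuclideanSpace ℝ (Fin d)),
      y ∈ U → y' ∈ U → pdiff (κ j) k y y' u ≤ L * ‖y - y'‖)
    (Ustat : (Fin n → EuclideanSpace ℝ (Fin d)) → ℝ)
    (hU : Ustat = fun x => ((n.choose m : ℝ))⁻¹ *
      ∑ j ∈ Finset.univ.filter (fun j : Fin m → Fin n => StrictMono j),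
        κ j (fun i => x (j i))) :
    ∀ (x : Fin n → EuclideanSpace ℝ (Fin d)), (∀ i, x i ∈ U) →
      ∀ (k : Fin n) (y y' : EuclideanSpace ℝ (Fin d)), y ∈ U → y' ∈ U →
      pdiff Ustat k y y' x ≤ (L * m / n) * ‖y - y'‖ := by
  intro x hx k y y' hy hy'
  have hn : (0:ℝ) < n := by exact_mod_cast k.pos
  have hc : (0:ℝ) < n.choose m := by exact_mod_cast Nat.choose_pos hmn
  have key : ∀ j ∈ Finset.univ.filter (fun j : Fin m → Fin n => StrictMono j),
      κ j (fun i => Function.update x k y (j i)) - κ j (fun i => Function.update x k y' (j i))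
        ≤ if (∃ i, j i = k) then L * ‖y - y'‖ else 0 := by
    intro j hj
    have hj : StrictMono j := by simpa using hj
    split_ifs with h
    · obtain ⟨i, rfl⟩ := h
      have := hκ j hj (fun i => x (j i)) (fun i => hx _) i y y' hy hy'
      have e : ∀ z, (fun l => Function.update x (j i) z (j l))
          = Function.update (fun l => x (j l)) i z := fun z =>
        Function.update_comp_eq_of_injective x hj.injective i z
      rw [e, e]
      exact this
    · have e : ∀ z, (fun l => Function.update x k z (j l)) = fun l => x (j l) := by
        intro z; funext l
        exact Function.update_of_ne (fun hl => h ⟨l, hl⟩) _ _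
      rw [e, e, sub_self]
  have hs := Finset.sum_le_sum key
  rw [← Finset.sum_filter, Finset.sum_const, Finset.filter_filter, nsmul_eq_mul,
    Finset.sum_sub_distrib] at hs
  have hcount : ((Finset.univ.filter
      (fun j : Fin m → Fin n => StrictMono j ∧ ∃ i, j i = k)).card : ℝ) * n
      = m * n.choose m := by exact_mod_cast count_aux n m k
  have hcount' := (eq_div_iff hn.ne').2 hcount
  rw [hcount'] at hs
  rw [hU]
  unfold pdiff
  rw [← mul_sub]
  refine (mul_le_mul_of_nonneg_left hs (inv_nonneg.2 hc.le)).trans (le_of_eq ?_)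
  field_simp
end

section
/- Let F : [0,1] → ℝ and define the L-statistic ℒ_F : [0,1]^n → ℝ by ℒ_F(x) = (1/n) Σ_{i=1}^n F(i/n) x_{(i)}, where (x_{(1)},…,x_{(n)}) is the nondecreasing rearrangement (order statistic) of x. Then for every x ∈ [0,1]^n, every k ∈ {1,…,n} and all y, y′ ∈ [0,1], |D^k_{y,y′} ℒ_F(x)| ≤ (‖F‖_∞ / n) · diam([[y, y′]]), where ‖F‖_∞ = sup_{t ∈ [0,1]} |F(t)| and [[α,β]] denotes the interval [min{α,β}, max{α,β}] (so diam([[y,y′]]) = |y − y′|). -/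
/-- The L-statistic `ℒ_F(x) = (1/n) ∑_{i=1}^n F(i/n) x_{(i)}`, where
`x_{(1)} ≤ … ≤ x_{(n)}` is the nondecreasing rearrangement of `x`. -/
noncomputable def Lstat {n : ℕ} (F : ℝ → ℝ) (x : Fin n → ℝ) : ℝ :=
  (1 / (n : ℝ)) * ∑ i : Fin n, F (((i : ℕ) + 1 : ℝ) / n) * x (Tuple.sort x i)

theorem sort_mono_aux {n : ℕ} (u v : Fin n → ℝ) (h : ∀ i, u i ≤ v i) (i : Fin n) :
    u (Tuple.sort u i) ≤ v (Tuple.sort v i) := by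
  by_contra hlt
  rw [not_le] at hlt
  have key : ∀ j ∈ Finset.Iic i, (Tuple.sort u).symm (Tuple.sort v j) ∈ Finset.Iio i := by
    intro j hj
    rw [Finset.mem_Iic] at hj
    rw [Finset.mem_Iio]
    by_contra hge
    rw [not_lt] at hge
    have h1 := Tuple.monotone_sort u hge
    have h2 := Tuple.monotone_sort v hj
    simp only [Function.comp, Equiv.apply_symm_apply] at h1 h2
    have h3 := h (Tuple.sort v j)
    linarith
  have hc := Finset.card_le_card_of_injOn _ key
    (fun a _ b _ hab => (Tuple.sort v).injective ((Tuple.sort u).symm.injective hab))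
  rw [Fin.card_Iic, Fin.card_Iio] at hc
  omega

theorem Lstat_aux {n : ℕ} (F : ℝ → ℝ) (C : ℝ)
    (hC : ∀ t ∈ Set.Icc (0 : ℝ) 1, |F t| ≤ C) (x : Fin n → ℝ) (k : Fin n) (y y' : ℝ)
    (hy : y' ≤ y) : |pdiff (Lstat F) k y y' x| ≤ (C / n) * |y - y'| := by
  have hn : (0 : ℝ) < n := by exact_mod_cast (Nat.zero_lt_of_lt k.2)
  unfold pdiff Lstat
  set u := Function.update x k y' with hu
  set v := Function.update x k y with hv
  have huv : ∀ i, u i ≤ v i := by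
    intro i
    by_cases hi : i = k
    · subst hi; simpa [hu, hv] using hy
    · simp [hu, hv, hi]
  have hm := sort_mono_aux u v huv
  have hsum : ∑ i, (v (Tuple.sort v i) - u (Tuple.sort u i)) = y - y' := by
    rw [Finset.sum_sub_distrib, Equiv.sum_comp (Tuple.sort v) v, Equiv.sum_comp (Tuple.sort u) u,
      ← Finset.sum_sub_distrib, Finset.sum_eq_single k]
    · simp [hu, hv]
    · intro b _ hb
      simp [hu, hv, hb]
    · simp
  rw [← mul_sub, ← Finset.sum_sub_distrib, abs_mul, abs_of_pos (by positivity : (0:ℝ) < 1 / n),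
    abs_of_nonneg (sub_nonneg.2 hy), one_div_mul_eq_div, div_mul_eq_mul_div]
  gcongr
  rw [← hsum, Finset.mul_sum]
  refine (Finset.abs_sum_le_sum_abs _ _).trans (Finset.sum_le_sum fun i _ => ?_)
  rw [← mul_sub, abs_mul, abs_of_nonneg (sub_nonneg.2 (hm i))]
  refine mul_le_mul_of_nonneg_right (hC _ ⟨by positivity, ?_⟩) (sub_nonneg.2 (hm i))
  rw [div_le_one hn]
  exact_mod_cast i.2

/-- First-order bound for L-statistics: if `‖F‖_∞ ≤ C` on `[0,1]`, then
`|D^k_{y,y'} ℒ_F(x)| ≤ (C/n)·|y - y'|` for `x ∈ [0,1]^n` and `y, y' ∈ [0,1]`. -/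
theorem Lstat_first_order {n : ℕ} (F : ℝ → ℝ) (C : ℝ)
    (hC : ∀ t ∈ Set.Icc (0 : ℝ) 1, |F t| ≤ C) :
    ∀ (x : Fin n → ℝ), (∀ i, x i ∈ Set.Icc (0 : ℝ) 1) →
      ∀ (k : Fin n) (y y' : ℝ), y ∈ Set.Icc (0 : ℝ) 1 → y' ∈ Set.Icc (0 : ℝ) 1 →
      |pdiff (Lstat F) k y y' x| ≤ (C / n) * |y - y'| := by
  intro x _ k y y' _ _
  rcases le_total y' y with h | h
  · exact Lstat_aux F C hC x k y y' h
  · have := Lstat_aux F C hC x k y' y h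
    rw [abs_sub_comm y y']
    unfold pdiff at this ⊢
    rwa [abs_sub_comm]
end

section
/- Let F : [0,1] → ℝ be Lipschitz with constant ‖F‖_Lip and define the L-statistic ℒ_F : [0,1]^n → ℝ by ℒ_F(x) = (1/n) Σ_{i=1}^n F(i/n) x_{(i)}, where (x_{(1)},…,x_{(n)}) is the nondecreasing rearrangement (order statistic) of x. Then for every x ∈ [0,1]^n, all k ≠ l in {1,…,n} and all y, y′, z, z′ ∈ [0,1], |D^l_{z,z′} D^k_{y,y′} ℒ_F(x)| ≤ (‖F‖_Lip / n²) · diam([[z, z′]] ∩ [[y, y′]]), where [[α,β]] denotes the interval [min{α,β}, max{α,β}] and diam denotes the diameter (with diam(∅) = 0). -/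
open MeasureTheory in
lemma aux_int (a : ℝ) (ha : a ∈ Set.Icc (0 : ℝ) 1) :
    ∫ t in Set.Ioc (0 : ℝ) 1, (Set.Iio a).indicator (fun _ => (1 : ℝ)) t = a := by
  rw [setIntegral_indicator measurableSet_Iio]
  have : Set.Ioc (0 : ℝ) 1 ∩ Set.Iio a = Set.Ioo 0 a := by
    ext t
    simp only [Set.mem_inter_iff, Set.mem_Ioc, Set.mem_Iio, Set.mem_Ioo]
    constructor
    · rintro ⟨⟨h1, h2⟩, h3⟩
      exact ⟨h1, h3⟩
    · rintro ⟨h1, h2⟩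
      exact ⟨⟨h1, by linarith [ha.2]⟩, h2⟩
  rw [this]
  simp [ha.1]

noncomputable def hfun {n : ℕ} (F : ℝ → ℝ) (x : Fin n → ℝ) (t : ℝ) : ℝ :=
  ∑ i : Fin n, F (((i : ℕ) + 1 : ℝ) / n) *
    (Set.Iio (x (Tuple.sort x i))).indicator (fun _ => (1 : ℝ)) t

open MeasureTheory in
lemma aux_ind_integrable (a : ℝ) :
    Integrable ((Set.Iio a).indicator (fun _ => (1 : ℝ))) (volume.restrict (Set.Ioc (0 : ℝ) 1)) :=
  (integrable_const (1 : ℝ)).indicator measurableSet_Iio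

open MeasureTheory in
lemma hfun_integrable {n : ℕ} (F : ℝ → ℝ) (x : Fin n → ℝ) :
    Integrable (hfun F x) (volume.restrict (Set.Ioc (0 : ℝ) 1)) := by
  unfold hfun
  exact integrable_finsetSum _ fun i _ => (aux_ind_integrable _).const_mul _

open MeasureTheory in
lemma Lstat_eq {n : ℕ} (F : ℝ → ℝ) (x : Fin n → ℝ) (hx : ∀ i, x i ∈ Set.Icc (0 : ℝ) 1) :
    Lstat F x = (1 / (n : ℝ)) * ∫ t in Set.Ioc (0 : ℝ) 1, hfun F x t := by
  unfold Lstat hfun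
  rw [integral_finsetSum _ fun i _ => (aux_ind_integrable _).const_mul _]
  congr 1
  refine Finset.sum_congr rfl fun i _ => ?_
  rw [integral_const_mul, aux_int _ (hx _)]

noncomputable def Gfun (n : ℕ) (F : ℝ → ℝ) (m : ℕ) : ℝ :=
  ∑ i : Fin n, if m ≤ (i : ℕ) then F (((i : ℕ) + 1 : ℝ) / n) else 0

lemma Gfun_succ (n : ℕ) (F : ℝ → ℝ) (m : ℕ) (hm : m < n) :
    Gfun n F m - Gfun n F (m + 1) = F ((m + 1 : ℝ) / n) := by
  unfold Gfun
  rw [← Finset.sum_sub_distrib, Finset.sum_eq_single (⟨m, hm⟩ : Fin n)]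
  · simp
  · intro b _ hb
    have : (b : ℕ) ≠ m := fun h => hb (Fin.ext h)
    by_cases h : m ≤ (b : ℕ)
    · have h' : m + 1 ≤ (b : ℕ) := by omega
      simp [h, h']
    · have h' : ¬ (m + 1 ≤ (b : ℕ)) := by omega
      simp [h, h']
  · simp

lemma hfun_eq {n : ℕ} (F : ℝ → ℝ) (x : Fin n → ℝ) (t : ℝ) :
    hfun F x t = Gfun n F (∑ j, if x j ≤ t then 1 else 0) := by
  unfold hfun Gfun
  refine Finset.sum_congr rfl fun i _ => ?_
  have h := Tuple.lt_card_le_iff_apply_le_of_monotone (f := x ∘ Tuple.sort x) (a := t) (j := i)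
    (Tuple.monotone_sort x)
  have hc : (∑ j, if x j ≤ t then 1 else 0) =
      (Finset.univ.filter fun i => (x ∘ Tuple.sort x) i ≤ t).card := by
    rw [← Equiv.sum_comp (Tuple.sort x), Finset.card_filter]
    rfl
  rw [hc]
  by_cases hi : x (Tuple.sort x i) ≤ t
  · have h2 := h.2 hi
    rw [if_neg (by omega), Set.indicator_of_notMem (by simpa using hi)]
    simp
  · have h2 := mt h.1 hi
    rw [if_pos (by omega), Set.indicator_of_mem (by simpa using hi)]
    simp

lemma count_update {n : ℕ} (x : Fin n → ℝ) (k l : Fin n) (hkl : k ≠ l) (t y z : ℝ) :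
    (∑ j, if Function.update (Function.update x l z) k y j ≤ t then 1 else 0) =
    (∑ j ∈ (Finset.univ.erase k).erase l, if x j ≤ t then 1 else 0) +
      (if y ≤ t then 1 else 0) + (if z ≤ t then 1 else 0) := by
  rw [← Finset.add_sum_erase _ _ (Finset.mem_univ k),
    ← Finset.add_sum_erase (Finset.univ.erase k) _ (Finset.mem_erase.2 ⟨hkl.symm, Finset.mem_univ l⟩)]
  have : (∑ j ∈ (Finset.univ.erase k).erase l,
      if Function.update (Function.update x l z) k y j ≤ t then 1 else 0) =
      (∑ j ∈ (Finset.univ.erase k).erase l, if x j ≤ t then 1 else 0) := by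
    refine Finset.sum_congr rfl fun j hj => ?_
    simp only [Finset.mem_erase] at hj
    rw [Function.update_of_ne hj.2.1, Function.update_of_ne hj.1]
  rw [this, Function.update_self, Function.update_of_ne hkl.symm, Function.update_self]
  ring

lemma count_bound {n : ℕ} (x : Fin n → ℝ) (k l : Fin n) (hkl : k ≠ l) (t : ℝ) :
    (∑ j ∈ (Finset.univ.erase k).erase l, if x j ≤ t then 1 else 0) + 2 ≤ n := by
  have h1 : (∑ j ∈ (Finset.univ.erase k).erase l, if x j ≤ t then 1 else 0) ≤
      ((Finset.univ.erase k).erase l).card := by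
    rw [← Finset.card_filter]
    exact Finset.card_filter_le _ _
  rw [Finset.card_erase_of_mem (Finset.mem_erase.2 ⟨hkl.symm, Finset.mem_univ l⟩),
    Finset.card_erase_of_mem (Finset.mem_univ k), Finset.card_univ, Fintype.card_fin] at h1
  have := k.2
  have := l.2
  have : (k : ℕ) ≠ l := fun h => hkl (Fin.ext h)
  omega

lemma pointwise {n : ℕ} (F : ℝ → ℝ) (K : ℝ)
    (hK : ∀ s ∈ Set.Icc (0 : ℝ) 1, ∀ t ∈ Set.Icc (0 : ℝ) 1, |F s - F t| ≤ K * |s - t|)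
    (x : Fin n → ℝ) (k l : Fin n) (hkl : k ≠ l) (y y' z z' t : ℝ) :
    |hfun F (Function.update (Function.update x l z) k y) t
      - hfun F (Function.update (Function.update x l z) k y') t
      - (hfun F (Function.update (Function.update x l z') k y) t
      - hfun F (Function.update (Function.update x l z') k y') t)|
    ≤ (Set.uIcc z z' ∩ Set.uIcc y y').indicator (fun _ => K / n) t := by
  have hK0 : 0 ≤ K := by
    have := hK 0 (by simp) 1 (by simp)
    have h2 := abs_nonneg (F 0 - F 1)
    simp at this
    linarith
  simp only [hfun_eq, count_update x k l hkl]
  have hB := count_bound x k l hkl t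
  generalize (∑ j ∈ (Finset.univ.erase k).erase l, if x j ≤ t then 1 else 0) = B at hB
  have hn : (0 : ℝ) < n := by
    have : 0 < n := by omega
    exact_mod_cast this
  have e1 := Gfun_succ n F B (by omega)
  have e2 := Gfun_succ n F (B + 1) (by omega)
  have hBn : (B : ℝ) + 2 ≤ n := by exact_mod_cast hB
  have hB0 : (0 : ℝ) ≤ B := Nat.cast_nonneg B
  have e3 : |Gfun n F B - 2 * Gfun n F (B + 1) + Gfun n F (B + 1 + 1)| ≤ K / n := by
    have h3 := hK (((B : ℝ) + 1) / n) ⟨by positivity, by rw [div_le_one hn]; linarith⟩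
      ((((B + 1 : ℕ) : ℝ) + 1) / n)
      ⟨by positivity, by rw [div_le_one hn]; push_cast; linarith⟩
    rw [← e1, ← e2] at h3
    have h4 : |((B : ℝ) + 1) / n - (((B + 1 : ℕ) : ℝ) + 1) / n| = 1 / n := by
      rw [← sub_div, abs_div, abs_of_pos hn]
      congr 1
      push_cast
      rw [show (B : ℝ) + 1 - (B + 1 + 1) = -1 by ring]
      simp
    rw [h4] at h3
    calc _ = _ := by congr 1; ring
      _ ≤ _ := h3
      _ = _ := by ring
  have hnn : 0 ≤ (Set.uIcc z z' ∩ Set.uIcc y y').indicator (fun _ => K / (n : ℝ)) t :=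
    Set.indicator_nonneg (fun _ _ => by positivity) t
  by_cases hy : (y ≤ t ↔ y' ≤ t)
  · simp only [hy]; simpa using hnn
  by_cases hz : (z ≤ t ↔ z' ≤ t)
  · simp only [hz]; simpa using hnn
  have hty : t ∈ Set.uIcc y y' := by
    rw [Set.mem_uIcc]
    by_contra hcon
    grind
  have htz : t ∈ Set.uIcc z z' := by
    rw [Set.mem_uIcc]
    by_contra hcon
    grind
  rw [Set.indicator_of_mem (Set.mem_inter htz hty)]
  have e4 := abs_le.1 e3
  by_cases h1 : y ≤ t <;> by_cases h2 : y' ≤ t <;> by_cases h3 : z ≤ t <;> by_cases h4 : z' ≤ t <;>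
    simp only [h1, h2, h3, h4, not_true_eq_false, iff_true, if_true, if_false, add_zero,
      iff_self, not_false_eq_true] at hy hz ⊢ <;>
    rw [abs_le] <;> constructor <;> linarith [e4.1, e4.2]

lemma diam_eq (y y' z z' : ℝ) :
    MeasureTheory.volume.real (Set.uIcc z z' ∩ Set.uIcc y y') =
      Metric.diam (Set.uIcc z z' ∩ Set.uIcc y y') := by
  unfold Set.uIcc
  rw [Set.Icc_inter_Icc]
  rcases le_or_gt (z ⊓ z' ⊔ y ⊓ y') ((z ⊔ z') ⊓ (y ⊔ y')) with h | h
  · rw [Real.diam_Icc h, Real.volume_real_Icc_of_le h]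
  · rw [Set.Icc_eq_empty (not_le.2 h)]
    simp

open MeasureTheory in
theorem Lstat_second_order {n : ℕ} (F : ℝ → ℝ) (K : ℝ)
    (hK : ∀ s ∈ Set.Icc (0 : ℝ) 1, ∀ t ∈ Set.Icc (0 : ℝ) 1, |F s - F t| ≤ K * |s - t|) :
    ∀ (x : Fin n → ℝ), (∀ i, x i ∈ Set.Icc (0 : ℝ) 1) →
      ∀ (k l : Fin n), k ≠ l →
      ∀ (y y' z z' : ℝ), y ∈ Set.Icc (0 : ℝ) 1 → y' ∈ Set.Icc (0 : ℝ) 1 →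
        z ∈ Set.Icc (0 : ℝ) 1 → z' ∈ Set.Icc (0 : ℝ) 1 →
      |pdiff (fun w => pdiff (Lstat F) k y y' w) l z z' x|
        ≤ (K / (n : ℝ) ^ 2) * Metric.diam (Set.uIcc z z' ∩ Set.uIcc y y') := by
  intro x hx k l hkl y y' z z' hy hy' hz hz'
  have hK0 : 0 ≤ K := by
    have := hK 0 (by simp) 1 (by simp)
    have h2 := abs_nonneg (F 0 - F 1)
    simp at this
    linarith
  have hu : ∀ a b : ℝ, a ∈ Set.Icc (0 : ℝ) 1 → b ∈ Set.Icc (0 : ℝ) 1 →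
      ∀ i, Function.update (Function.update x l a) k b i ∈ Set.Icc (0 : ℝ) 1 := by
    intro a b ha hb i
    by_cases h1 : i = k
    · subst h1; rwa [Function.update_self]
    · rw [Function.update_of_ne h1]
      by_cases h2 : i = l
      · subst h2; rwa [Function.update_self]
      · rw [Function.update_of_ne h2]; exact hx i
  have hint : ∀ a b : Fin n → ℝ, Integrable (fun t => hfun F a t - hfun F b t)
      (volume.restrict (Set.Ioc (0 : ℝ) 1)) :=
    fun a b => (hfun_integrable _ _).sub (hfun_integrable _ _)
  simp only [pdiff]
  rw [Lstat_eq F _ (hu z y hz hy), Lstat_eq F _ (hu z y' hz hy'),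
    Lstat_eq F _ (hu z' y hz' hy), Lstat_eq F _ (hu z' y' hz' hy')]
  rw [← mul_sub, ← mul_sub, ← mul_sub,
    ← integral_sub (hfun_integrable _ _) (hfun_integrable _ _),
    ← integral_sub (hfun_integrable _ _) (hfun_integrable _ _),
    ← integral_sub (hint _ _) (hint _ _)]
  have hm : MeasurableSet (Set.uIcc z z' ∩ Set.uIcc y y') :=
    measurableSet_uIcc.inter measurableSet_uIcc
  have hle := norm_integral_le_of_norm_le (μ := volume.restrict (Set.Ioc (0 : ℝ) 1))
    (f := fun t => hfun F (Function.update (Function.update x l z) k y) t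
      - hfun F (Function.update (Function.update x l z) k y') t
      - (hfun F (Function.update (Function.update x l z') k y) t
      - hfun F (Function.update (Function.update x l z') k y') t))
    ((integrable_const (K / (n : ℝ))).indicator hm)
    (Filter.Eventually.of_forall (pointwise F K hK x k l hkl y y' z z'))
  rw [integral_indicator_const _ hm, Real.norm_eq_abs] at hle
  have hfin : volume (Set.uIcc z z' ∩ Set.uIcc y y') ≠ ⊤ :=
    ((measure_mono Set.inter_subset_left).trans_lt isCompact_uIcc.measure_lt_top).ne
  have hr : (volume.restrict (Set.Ioc (0 : ℝ) 1)).real (Set.uIcc z z' ∩ Set.uIcc y y') ≤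
      volume.real (Set.uIcc z z' ∩ Set.uIcc y y') :=
    ENNReal.toReal_mono hfin (Measure.restrict_apply_le _ _)
  rw [diam_eq] at hr
  rw [abs_mul, abs_of_nonneg (by positivity : (0 : ℝ) ≤ 1 / n)]
  calc _ ≤ 1 / (n : ℝ) * (Metric.diam (Set.uIcc z z' ∩ Set.uIcc y y') * (K / n)) := by
        refine mul_le_mul_of_nonneg_left (hle.trans ?_) (by positivity)
        rw [smul_eq_mul]
        exact mul_le_mul_of_nonneg_right hr (by positivity)
    _ = _ := by ring
end

section
/- Let 𝒰 ⊆ ℝ^d be convex and bounded with diameter Δ, and suppose f : 𝒰^n → ℝ extends to a C² function on an open set 𝒱 containing 𝒰^n. Then J_Lip(f) ≤ n · Δ · max_{k ≠ l} ‖∂_{kl} f‖, where ∂_{kl} f(x) ∈ ℝ^{d×d} is the matrix of second partial derivatives pairing the k-th and l-th coordinate blocks, and ‖∂_{kl} f‖ = sup_{x ∈ 𝒰^n} ‖∂_{kl} f(x)‖_op is the supremum of its operator norm. -/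
theorem aux_hasFDerivAt {d n : ℕ} {V : Set (Fin n → EuclideanSpace ℝ (Fin d))}
    (hVopen : IsOpen V) {g : (Fin n → EuclideanSpace ℝ (Fin d)) → ℝ}
    (hg : ContDiffOn ℝ 2 g V) (w : Fin n → EuclideanSpace ℝ (Fin d)) (k : Fin n)
    (q : EuclideanSpace ℝ (Fin d)) (hw : Function.update w k q ∈ V) :
    HasFDerivAt (fun q => g (Function.update w k q))
      ((fderiv ℝ g (Function.update w k q)).comp
        (ContinuousLinearMap.pi (Pi.single k (ContinuousLinearMap.id ℝ _)))) q := by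
  have h1 : DifferentiableAt ℝ g (Function.update w k q) :=
    (hg.contDiffAt (hVopen.mem_nhds hw)).differentiableAt (by norm_num)
  exact h1.hasFDerivAt.comp q (hasFDerivAt_update w q)

theorem aux_diff {d n : ℕ} {V : Set (Fin n → EuclideanSpace ℝ (Fin d))}
    (hVopen : IsOpen V) {g : (Fin n → EuclideanSpace ℝ (Fin d)) → ℝ}
    (hg : ContDiffOn ℝ 2 g V) (x : Fin n → EuclideanSpace ℝ (Fin d)) (k l : Fin n)
    (hkl : k ≠ l)
    (p q : EuclideanSpace ℝ (Fin d))
    (hw : Function.update (Function.update x l p) k q ∈ V) :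
    DifferentiableAt ℝ (fun p => fderiv ℝ (fun q =>
      g (Function.update (Function.update x l p) k q)) q) p := by
  have hu : DifferentiableAt ℝ
      (fun p => Function.update (Function.update x l p) k q) p := by
    have : (fun p => Function.update (Function.update x l p) k q)
        = fun p => Function.update (Function.update x k q) l p := by
      funext p
      exact Function.update_comm hkl.symm _ _ _
    rw [this]
    exact (hasFDerivAt_update (Function.update x k q) p).differentiableAt
  have h2 : DifferentiableAt ℝ (fderiv ℝ g)
      (Function.update (Function.update x l p) k q) :=
    ((hg.contDiffAt (hVopen.mem_nhds hw)).fderiv_right (m := 1)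
      (by norm_num)).differentiableAt (by norm_num)
  have h3 : DifferentiableAt ℝ
      (fun p => fderiv ℝ g (Function.update (Function.update x l p) k q)) p :=
    DifferentiableAt.comp p h2 hu
  have h4 := h3.clm_comp (differentiableAt_const
    (ContinuousLinearMap.pi (Pi.single k (ContinuousLinearMap.id ℝ _)) :
      EuclideanSpace ℝ (Fin d) →L[ℝ] (Fin n → EuclideanSpace ℝ (Fin d))))
  refine h4.congr_of_eventuallyEq ?_
  filter_upwards [hu.continuousAt.preimage_mem_nhds (hVopen.mem_nhds hw)] with p' hp'
  exact (aux_hasFDerivAt hVopen hg _ k q hp').fderiv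

/-- If `U ⊆ ℝ^d` is convex and bounded with diameter `Δ` and `f : U^n → ℝ` extends to a
`C²` function `g` on an open set `V ⊇ U^n`, then `J_Lip(f) ≤ n Δ max_{k ≠ l} ‖∂_{kl} f‖`:
whenever `C` bounds the operator norms of all the mixed second derivative blocks
`∂_{kl} f(x)` (`k ≠ l`, `x ∈ U^n`), then for all `k ≠ l`, `x ∈ U^n` and
`y, y', z, z' ∈ U` one has `n · D^l_{z,z'} D^k_{y,y'} f(x) ≤ n Δ C ‖y - y'‖`. -/
theorem differentiation_JLip {d n : ℕ} (U : Set (EuclideanSpace ℝ (Fin d)))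
    (hUconv : Convex ℝ U) (hUbdd : Bornology.IsBounded U)
    (Δ : ℝ) (hΔ : Metric.diam U = Δ)
    (f g : (Fin n → EuclideanSpace ℝ (Fin d)) → ℝ)
    (V : Set (Fin n → EuclideanSpace ℝ (Fin d))) (hVopen : IsOpen V)
    (hUV : {x : Fin n → EuclideanSpace ℝ (Fin d) | ∀ i, x i ∈ U} ⊆ V)
    (hg : ContDiffOn ℝ 2 g V)
    (hfg : ∀ x : Fin n → EuclideanSpace ℝ (Fin d), (∀ i, x i ∈ U) → f x = g x)
    (C : ℝ)
    (hC : ∀ (k l : Fin n), k ≠ l →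
      ∀ (x : Fin n → EuclideanSpace ℝ (Fin d)), (∀ i, x i ∈ U) →
      ‖fderiv ℝ (fun p : EuclideanSpace ℝ (Fin d) =>
          fderiv ℝ (fun q : EuclideanSpace ℝ (Fin d) =>
            g (Function.update (Function.update x l p) k q)) (x k)) (x l)‖ ≤ C) :
    ∀ (x : Fin n → EuclideanSpace ℝ (Fin d)), (∀ i, x i ∈ U) →
      ∀ (k l : Fin n), k ≠ l →
      ∀ (y y' z z' : EuclideanSpace ℝ (Fin d)), y ∈ U → y' ∈ U → z ∈ U → z' ∈ U →
      (n : ℝ) * pdiff (fun w => pdiff f k y y' w) l z z' x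
        ≤ (n : ℝ) * Δ * C * ‖y - y'‖ := by
  intro x hx k l hkl y y' z z' hy hy' hz hz'
  have hmem : ∀ p ∈ U, ∀ q ∈ U, ∀ i,
      Function.update (Function.update x l p) k q i ∈ U := by
    intro p hp q hq i
    by_cases h1 : i = k
    · subst h1; simpa using hq
    · by_cases h2 : i = l
      · subst h2; simpa [h1] using hp
      · simpa [h1, h2] using hx i
  have hC0 : 0 ≤ C := le_trans (ContinuousLinearMap.opNorm_nonneg _) (hC k l hkl x hx)
  have hbound : ∀ q ∈ U,
      ‖fderiv ℝ (fun q => g (Function.update (Function.update x l z) k q)) q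
        - fderiv ℝ (fun q => g (Function.update (Function.update x l z') k q)) q‖
        ≤ C * Δ := by
    intro q hq
    have hmv := hUconv.norm_image_sub_le_of_norm_fderiv_le (𝕜 := ℝ) (C := C)
      (f := fun p => fderiv ℝ (fun q =>
        g (Function.update (Function.update x l p) k q)) q)
      (fun p hp => aux_diff hVopen hg x k l hkl p q (hUV (hmem p hp q hq)))
      (fun p hp => by
        have h := hC k l hkl _ (hmem p hp q hq)
        have e1 : ∀ p' q', Function.update (Function.update
            (Function.update (Function.update x l p) k q) l p') k q'
            = Function.update (Function.update x l p') k q' := by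
          intro p' q'
          funext i
          by_cases h1 : i = k
          · subst h1; simp
          · by_cases h2 : i = l
            · subst h2; simp [h1]
            · simp [h1, h2]
        simpa only [e1, Function.update_self, Function.update_of_ne hkl.symm] using h)
      hz' hz
    refine hmv.trans (mul_le_mul_of_nonneg_left ?_ hC0)
    rw [← hΔ, ← dist_eq_norm]
    exact Metric.dist_le_diam_of_mem hUbdd hz hz'
  have hd : ∀ p ∈ U, ∀ q ∈ U, DifferentiableAt ℝ
      (fun q => g (Function.update (Function.update x l p) k q)) q :=
    fun p hp q hq => (aux_hasFDerivAt hVopen hg _ k q (hUV (hmem p hp q hq))).differentiableAt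
  have hfin := hUconv.norm_image_sub_le_of_norm_hasFDerivWithin_le (𝕜 := ℝ) (C := C * Δ)
    (f := fun q => g (Function.update (Function.update x l z) k q)
      - g (Function.update (Function.update x l z') k q))
    (fun q hq => ((hd z hz q hq).hasFDerivAt.sub
      (hd z' hz' q hq).hasFDerivAt).hasFDerivWithinAt)
    hbound hy' hy
  have hle := (le_abs_self _).trans hfin
  have heq : pdiff (fun w => pdiff f k y y' w) l z z' x
      = (g (Function.update (Function.update x l z) k y)
      - g (Function.update (Function.update x l z') k y))
      - (g (Function.update (Function.update x l z) k y')
      - g (Function.update (Function.update x l z') k y')) := by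
    simp only [pdiff]
    rw [hfg _ (hmem z hz y hy), hfg _ (hmem z hz y' hy'),
      hfg _ (hmem z' hz' y hy), hfg _ (hmem z' hz' y' hy')]
    ring
  rw [heq]
  calc _ ≤ (n : ℝ) * (C * Δ * ‖y - y'‖) := mul_le_mul_of_nonneg_left hle (Nat.cast_nonneg n)
    _ = _ := by ring
end

section
/- For every set 𝒳, every n ∈ ℕ, every function f : 𝒳^n → ℝ and all vectors x, x′ ∈ 𝒳^n, f(x) − f(x′) = Σ_{k=1}^n 2^{−k} Σ_{A ⊆ [1,k−1]} ( D^k_{x_k, x′_k} f(x^A) + D^k_{x_k, x′_k} f(x^{A ∪ [k,n]}) ), where the inner sum ranges over all subsets A of [1,k−1] = {1,…,k−1} (the empty set if k = 1) and [k,n] = {k,…,n}. -/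
/-- `x^A`: the vector whose `i`-th coordinate is `x'_i` if `i ∈ A` and `x_i` otherwise. -/
def subst {α : Type*} {n : ℕ} (x x' : Fin n → α) (A : Finset (Fin n)) : Fin n → α :=
  fun i => if i ∈ A then x' i else x i

/-- Interpolating quantity for the telescoping sum. -/
noncomputable def teleG {n : ℕ} (F : Finset (Fin n) → ℝ) (m : ℕ) : ℝ :=
  (1 / 2 ^ m : ℝ) * ∑ A ∈ (Finset.univ.filter (fun i : Fin n => (i : ℕ) < m)).powerset,
    (F A - F (A ∪ Finset.univ.filter (fun i : Fin n => m ≤ (i : ℕ))))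

theorem teleG_step {n : ℕ} (F : Finset (Fin n) → ℝ) (k : Fin n) :
    teleG F k - teleG F (k + 1) = (1 / 2 ^ ((k : ℕ) + 1) : ℝ) *
      ∑ A ∈ (Finset.Iio k).powerset,
        ((F A - F (insert k A)) + (F (A ∪ Finset.Ioi k) - F (A ∪ Finset.Ici k))) := by
  have h1 : Finset.univ.filter (fun i : Fin n => (i : ℕ) < k) = Finset.Iio k := by
    ext i; simp
  have h2 : Finset.univ.filter (fun i : Fin n => (i : ℕ) < (k : ℕ) + 1)
      = insert k (Finset.Iio k) := by
    ext i; simp only [Finset.mem_filter, Finset.mem_univ, true_and, Finset.mem_insert, Finset.mem_Iio, Fin.ext_iff, Fin.lt_def]; omega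
  have h3 : Finset.univ.filter (fun i : Fin n => (k : ℕ) ≤ i) = Finset.Ici k := by
    ext i; simp
  have h4 : Finset.univ.filter (fun i : Fin n => (k : ℕ) + 1 ≤ i) = Finset.Ioi k := by
    ext i; simp only [Finset.mem_filter, Finset.mem_univ, true_and, Finset.mem_Ioi, Fin.lt_def]; omega
  have h5 : ∀ A : Finset (Fin n), insert k A ∪ Finset.Ioi k = A ∪ Finset.Ici k := by
    intro A; ext i
    simp only [Finset.mem_union, Finset.mem_insert, Finset.mem_Ioi, Finset.mem_Ici,
      Fin.ext_iff, Fin.lt_def, Fin.le_def]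
    have : (k : ℕ) ≤ i ↔ (i : ℕ) = k ∨ (k : ℕ) < i := by omega
    tauto
  unfold teleG
  rw [h1, h2, h3, h4, Finset.sum_powerset_insert (by simp)]
  simp only [h5, Finset.sum_add_distrib, Finset.sum_sub_distrib]
  rw [pow_succ]
  field_simp
  ring

/-- Telescoping identity: for every `f : 𝒳^n → ℝ` and `x, x' ∈ 𝒳^n`,
`f(x) - f(x') = ∑_{k=1}^n 2^{-k} ∑_{A ⊆ [1,k-1]}
  (D^k_{x_k,x'_k} f(x^A) + D^k_{x_k,x'_k} f(x^{A ∪ [k,n]}))`. -/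
theorem telescoping_representation {𝒳 : Type*} {n : ℕ} (f : (Fin n → 𝒳) → ℝ)
    (x x' : Fin n → 𝒳) :
    f x - f x' = ∑ k : Fin n, (1 / 2 ^ ((k : ℕ) + 1) : ℝ) *
      ∑ A ∈ (Finset.Iio k).powerset,
        (pdiff f k (x k) (x' k) (subst x x' A) +
          pdiff f k (x k) (x' k) (subst x x' (A ∪ Finset.Ici k))) := by
  let F : Finset (Fin n) → ℝ := fun A => f (subst x x' A)
  have e : ∀ k : Fin n, (1 / 2 ^ ((k : ℕ) + 1) : ℝ) *
      ∑ A ∈ (Finset.Iio k).powerset,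
        (pdiff f k (x k) (x' k) (subst x x' A) +
          pdiff f k (x k) (x' k) (subst x x' (A ∪ Finset.Ici k)))
      = teleG F k - teleG F (k + 1) := by
    intro k
    rw [teleG_step]
    congr 1
    refine Finset.sum_congr rfl fun A hA => ?_
    have hk : k ∉ A := fun h => by
      have := Finset.mem_powerset.1 hA h
      simp at this
    have g1 : Function.update (subst x x' A) k (x k) = subst x x' A := by
      ext i; by_cases h : i = k
      · subst h; simp [_root_.subst, hk]
      · simp [h]
    have g2 : Function.update (subst x x' A) k (x' k) = subst x x' (insert k A) := by
      ext i; by_cases h : i = k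
      · subst h; simp [_root_.subst]
      · simp [h, _root_.subst]
    have g3 : Function.update (subst x x' (A ∪ Finset.Ici k)) k (x k)
        = subst x x' (A ∪ Finset.Ioi k) := by
      ext i; by_cases h : i = k
      · subst h; simp [_root_.subst, hk]
      · have : k ≤ i ↔ k < i := ⟨fun h' => lt_of_le_of_ne h' (Ne.symm h), le_of_lt⟩
        simp [h, _root_.subst, this]
    have g4 : Function.update (subst x x' (A ∪ Finset.Ici k)) k (x' k)
        = subst x x' (A ∪ Finset.Ici k) := by
      ext i; by_cases h : i = k
      · subst h; simp [_root_.subst]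
      · simp [h]
    simp only [pdiff, g1, g2, g3, g4, F]
  rw [Finset.sum_congr rfl fun k _ => e k,
    Fin.sum_univ_eq_sum_range (fun k => teleG F k - teleG F (k + 1)) n, Finset.sum_range_sub']
  have z : teleG F 0 = f x - f x' := by
    have a : subst x x' ∅ = x := by ext i; simp [_root_.subst]
    have b : subst x x' Finset.univ = x' := by ext i; simp [_root_.subst]
    simp [teleG, F, a, b]
  have w : teleG F n = 0 := by
    have : Finset.univ.filter (fun i : Fin n => n ≤ (i : ℕ)) = ∅ := by
      ext i; simp
    simp [teleG, this]
  rw [z, w, sub_zero]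
end
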